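/- arXiv:1512.01932 — 10 statements merged into one kernel-verified Lean document; each statement's English description precedes it below -/
import Mathlib

section
/- Let F be a finite field with q elements and let A₃* denote the set of nonnegative integers none of whose base-3 digits equals 2. Suppose f ∈ F[X] is a nonzero polynomial such that the multiplicity of every monic irreducible factor of f lies in A₃*. Then there do not exist a nonzero polynomial b ∈ F[X] and a nonzero non-unit r ∈ F[X] with b, r·b, and r²·b all having the property that the multiplicity of every monic irreducible factor lies in A₃*, whenever f equals one of these three terms; equivalently, the set of nonzero polynomials in F[X] all of whose irreducible-factor multiplicities lie in A₃* contains no 3-term geometric progression b, r·b, r²·b with r a nonzero non-unit. -/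
/-- `A3` is the set of nonnegative integers none of whose base-3 digits equals 2. -/
def A3 : Set ℕ := {n : ℕ | ∀ d ∈ Nat.digits 3 n, d ≠ 2}

/-- Every monic irreducible factor of `f` occurs with multiplicity lying in `A3`. -/
def GoodMult {F : Type*} [Field F] (f : Polynomial F) : Prop :=
  ∀ P : Polynomial F, P.Monic → Irreducible P →
    ∀ k : ℕ, P ^ k ∣ f → ¬ P ^ (k + 1) ∣ f → k ∈ A3

theorem zero_mem_A3 : 0 ∈ A3 := by simp [A3]

theorem mem_A3_iff_of_pos {n : ℕ} (hn : 0 < n) : n ∈ A3 ↔ n % 3 ≠ 2 ∧ n / 3 ∈ A3 := by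
  simp only [A3, Set.mem_ofPred_eq, Nat.digits_def' (by norm_num : 1 < 3) hn, List.forall_mem_cons]

theorem mem_A3_iff (n : ℕ) : n ∈ A3 ↔ n % 3 ≠ 2 ∧ n / 3 ∈ A3 := by
  rcases n.eq_zero_or_pos with rfl | hn
  · simp [zero_mem_A3]
  · exact mem_A3_iff_of_pos hn

theorem threeAPFree_A3 : ThreeAPFree A3 := by
  intro a ha b hb c hc h
  induction hn : a + b using Nat.strong_induction_on generalizing a b c with
  | _ n ih =>
    by_cases h0 : n = 0
    · omega
    · have ha' := (mem_A3_iff a).1 ha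
      have hb' := (mem_A3_iff b).1 hb
      have hc' := (mem_A3_iff c).1 hc
      have hmod : a % 3 = b % 3 ∧ c % 3 = b % 3 := by
        have ha₁ : a % 3 = 0 ∨ a % 3 = 1 := by omega
        have hb₁ : b % 3 = 0 ∨ b % 3 = 1 := by omega
        have hc₁ : c % 3 = 0 ∨ c % 3 = 1 := by omega
        rcases ha₁ with ha₁ | ha₁ <;> rcases hb₁ with hb₁ | hb₁ <;>
          rcases hc₁ with hc₁ | hc₁ <;> omega
      have := ih (a / 3 + b / 3) (by omega) ha'.2 hb'.2 hc'.2 (by omega) rfl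
      omega

theorem GoodMult.multiplicity_mem {F : Type*} [Field F] {f P : Polynomial F} (hf : GoodMult f)
    (hf0 : f ≠ 0) (hP : P.Monic) (hirr : Irreducible P) : multiplicity P f ∈ A3 :=
  hf P hP hirr _ (pow_multiplicity_dvd P f)
    ((FiniteMultiplicity.of_prime_left hirr.prime hf0).not_pow_dvd_of_multiplicity_lt
      (Nat.lt_succ_self _))

theorem stmt_0 (F : Type*) [Field F] [Fintype F] :
    ¬ ∃ b r : Polynomial F, b ≠ 0 ∧ r ≠ 0 ∧ ¬ IsUnit r ∧
      GoodMult b ∧ GoodMult (r * b) ∧ GoodMult (r ^ 2 * b) := by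
  rintro ⟨b, r, hb, hr, hu, h₀, h₁, h₂⟩
  obtain ⟨P, hP, hirr, hdvd⟩ := Polynomial.exists_monic_irreducible_factor r hu
  have hrb : r * b ≠ 0 := mul_ne_zero hr hb
  have hrrb : r * (r * b) ≠ 0 := mul_ne_zero hr hrb
  rw [pow_two, mul_assoc] at h₂
  have m₀ := h₀.multiplicity_mem hb hP hirr
  have m₁ := h₁.multiplicity_mem hrb hP hirr
  have m₂ := h₂.multiplicity_mem hrrb hP hirr
  have e₁ := multiplicity_mul hirr.prime (FiniteMultiplicity.of_prime_left hirr.prime hrb)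
  have e₂ := multiplicity_mul hirr.prime (FiniteMultiplicity.of_prime_left hirr.prime hrrb)
  have hpos : multiplicity P r ≠ 0 := fun h ↦ multiplicity_eq_zero.1 h hdvd
  have := threeAPFree_A3 m₀ m₁ m₂ (by omega)
  omega
end

section
/- Let F be a finite field with q elements and let A₃* denote the set of nonnegative integers none of whose base-3 digits equals 2. If f ∈ F[X] is a nonzero polynomial having at least one monic irreducible factor whose multiplicity in f does not lie in A₃*, then there exists a nonzero non-unit r ∈ F[X] such that r² divides f and both f/r² and f/r have the property that the multiplicity of every monic irreducible factor lies in A₃*. -/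
open UniqueFactorizationMonoid

theorem Polynomial.count_normalizedFactors_eq_of_monic {F : Type*} [Field F] [DecidableEq F]
    {P g : Polynomial F} {k : ℕ} (hm : P.Monic) (hP : Irreducible P)
    (hk : P ^ k ∣ g) (hk' : ¬ P ^ (k + 1) ∣ g) : (normalizedFactors g).count P = k :=
  count_normalizedFactors_eq hP hm.normalize_eq_self hk hk'

theorem three_mul_add_mem_A3 {a e : ℕ} (ha : a ∈ A3) (he : e < 2) : 3 * a + e ∈ A3 := by
  rcases Nat.eq_zero_or_pos (3 * a + e) with h0 | h0
  · rw [h0]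
    simp [A3]
  · intro d hd
    rw [Nat.digits_def' (by norm_num) h0, List.mem_cons] at hd
    rcases hd with rfl | hd
    · lia
    · exact ha d (by rwa [show (3 * a + e) / 3 = a by lia] at hd)

theorem exists_sub_mem_A3 (n : ℕ) : ∃ d, 2 * d ≤ n ∧ n - 2 * d ∈ A3 ∧ n - d ∈ A3 := by
  induction n using Nat.strong_induction_on with
  | _ n ih =>
    rcases Nat.eq_zero_or_pos n with rfl | hn
    · exact ⟨0, by simp [A3]⟩
    · obtain ⟨d, hd, h₂, h₁⟩ := ih (n / 3) (by lia)
      by_cases he : n % 3 = 2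
      · refine ⟨3 * d + 1, by lia, ?_, ?_⟩
        · convert three_mul_add_mem_A3 h₂ (e := 0) (by norm_num) using 1
          lia
        · convert three_mul_add_mem_A3 h₁ (e := 1) (by norm_num) using 1
          lia
      · refine ⟨3 * d, by lia, ?_, ?_⟩
        · convert three_mul_add_mem_A3 h₂ (e := n % 3) (by lia) using 1
          lia
        · convert three_mul_add_mem_A3 h₁ (e := n % 3) (by lia) using 1
          lia

/-- A submultiset of the normalized factors with prescribed counts is realised by a polynomial. -/
theorem Polynomial.exists_count_normalizedFactors_eq {F : Type*} [Field F] [DecidableEq F]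
    (f : Polynomial F) (c : ℕ → ℕ) (hc : ∀ n, c n ≤ n) :
    ∃ r : Polynomial F, r ≠ 0 ∧
      ∀ P, (normalizedFactors r).count P = c ((normalizedFactors f).count P) := by
  set m : Multiset (Polynomial F) :=
    ∑ p ∈ (normalizedFactors f).toFinset, Multiset.replicate (c ((normalizedFactors f).count p)) p
  have hcount : ∀ P, m.count P = c ((normalizedFactors f).count P) := by
    intro P
    simp only [m, Multiset.count_sum', Multiset.count_replicate, Finset.sum_ite_eq',
      Multiset.mem_toFinset]
    split_ifs with h
    · rfl
    · rw [Multiset.count_eq_zero_of_notMem h]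
      exact (Nat.le_zero.mp (hc 0)).symm
  have hle : m ≤ normalizedFactors f :=
    Multiset.le_iff_count.mpr fun P => (hcount P).trans_le (hc _)
  have hirr : ∀ p ∈ m, Irreducible p := fun p hp =>
    irreducible_of_normalized_factor p (Multiset.mem_of_le hle hp)
  refine ⟨m.prod, Multiset.prod_ne_zero fun h0 => not_irreducible_zero (hirr 0 h0), fun P => ?_⟩
  rw [normalizedFactors_prod_eq m hirr, Multiset.map_congr rfl fun p hp =>
    normalize_normalized_factor p (Multiset.mem_of_le hle hp), Multiset.map_id', hcount]

theorem stmt_1 (F : Type*) [Field F] [Fintype F] (f : Polynomial F) (hf : f ≠ 0)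
    (h : ∃ (P : Polynomial F) (k : ℕ), P.Monic ∧ Irreducible P ∧
      P ^ k ∣ f ∧ ¬ P ^ (k + 1) ∣ f ∧ k ∉ A3) :
    ∃ r : Polynomial F, r ≠ 0 ∧ ¬ IsUnit r ∧ r ^ 2 ∣ f ∧
      GoodMult (f / r ^ 2) ∧ GoodMult (f / r) := by
  classical
  choose d hd h₂ h₁ using exists_sub_mem_A3
  obtain ⟨r, hr, hcount⟩ := f.exists_count_normalizedFactors_eq d fun n => by have := hd n; lia
  have hdvd : r ^ 2 ∣ f := by
    rw [dvd_iff_normalizedFactors_le_normalizedFactors (pow_ne_zero 2 hr) hf,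
      normalizedFactors_pow, Multiset.le_iff_count]
    intro P
    rw [Multiset.count_nsmul, hcount]
    exact hd _
  refine ⟨r, hr, fun hu => ?_, hdvd, ?_, ?_⟩
  · obtain ⟨P, k, hm, hP, hk, hk', hkA⟩ := h
    have hc := hcount P
    rw [normalizedFactors_of_isUnit hu,
      Polynomial.count_normalizedFactors_eq_of_monic hm hP hk hk', Multiset.count_zero] at hc
    exact hkA (by simpa [← hc] using h₁ k)
  · obtain ⟨s, rfl⟩ := hdvd
    rw [mul_div_cancel_left₀ s (pow_ne_zero 2 hr)]
    intro P hm hP k hk hk'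
    have hs : s ≠ 0 := right_ne_zero_of_mul hf
    have hc := hcount P
    rw [normalizedFactors_mul (pow_ne_zero 2 hr) hs, normalizedFactors_pow, Multiset.count_add,
      Multiset.count_nsmul, Polynomial.count_normalizedFactors_eq_of_monic hm hP hk hk'] at hc
    convert h₂ (2 * (normalizedFactors r).count P + k) using 1
    lia
  · obtain ⟨s, rfl⟩ := hdvd
    rw [show r ^ 2 * s = r * (r * s) by ring, mul_div_cancel_left₀ _ hr]
    intro P hm hP k hk hk'
    have hs : s ≠ 0 := right_ne_zero_of_mul hf
    have hc := hcount P
    rw [show r ^ 2 * s = r * (r * s) by ring, normalizedFactors_mul hr (mul_ne_zero hr hs),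
      Multiset.count_add, Polynomial.count_normalizedFactors_eq_of_monic hm hP hk hk'] at hc
    convert h₁ ((normalizedFactors r).count P + k) using 1
    lia
end

section
/- The set A₃* of nonnegative integers none of whose base-3 digits equals 2 contains no nontrivial 3-term arithmetic progression: there do not exist a, b, c ∈ A₃* with a < b < c and a + c = 2b. -/
theorem A3.mod_ne_two_and_div_mem {n : ℕ} (hn : n ∈ A3) : n % 3 ≠ 2 ∧ n / 3 ∈ A3 := by
  rcases Nat.eq_zero_or_pos n with rfl | hpos
  · simpa using hn
  · simpa only [A3, Set.mem_ofPred_eq, Nat.digits_def' (by norm_num : 1 < 3) hpos,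
      List.forall_mem_cons] using hn

theorem A3.eq_of_add_eq_two_mul {a b c : ℕ} (ha : a ∈ A3) (hb : b ∈ A3) (hc : c ∈ A3)
    (h : a + c = 2 * b) : a = b := by
  induction b using Nat.strong_induction_on generalizing a c with
  | _ b ih =>
    obtain ⟨ha₂, ha'⟩ := A3.mod_ne_two_and_div_mem ha
    obtain ⟨hb₂, hb'⟩ := A3.mod_ne_two_and_div_mem hb
    obtain ⟨hc₂, hc'⟩ := A3.mod_ne_two_and_div_mem hc
    rcases Nat.eq_zero_or_pos b with rfl | hpos
    · omega
    · have hdiv := ih (b / 3) (by omega) ha' hb' hc' (by omega)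
      omega

theorem stmt_2 :
    ¬ ∃ a b c : ℕ, a ∈ A3 ∧ b ∈ A3 ∧ c ∈ A3 ∧ a < b ∧ b < c ∧ a + c = 2 * b := by
  rintro ⟨a, b, c, ha, hb, hc, hab, -, h⟩
  exact hab.ne (A3.eq_of_add_eq_two_mul ha hb hc h)
end

section
/- For every nonnegative integer n not in A₃*, there exist a, b ∈ A₃* with a < b < n and a + n = 2b. (Together with the fact that A₃* contains no 3-term arithmetic progression, this shows that A₃* is exactly the set obtained by greedily including nonnegative integers in increasing order so as to avoid 3-term arithmetic progressions.) -/
theorem three_mul_add_mem_A3_s3 {m d : ℕ} (hm : m ∈ A3) (hd : d < 2) : 3 * m + d ∈ A3 := by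
  rcases Nat.eq_zero_or_pos (3 * m + d) with h | h
  · simp [A3, h]
  · have hmod : (3 * m + d) % 3 = d := by omega
    have hdiv : (3 * m + d) / 3 = m := by omega
    intro e he
    rw [Nat.digits_def' (by norm_num) h, hmod, hdiv, List.mem_cons] at he
    rcases he with rfl | he
    · exact hd.ne
    · exact hm e he

theorem exists_mem_A3_add_eq_two_mul (n : ℕ) :
    ∃ a b : ℕ, a ∈ A3 ∧ b ∈ A3 ∧ a ≤ b ∧ a + n = 2 * b := by
  induction n using Nat.strong_induction_on with
  | _ n ih =>
    rcases Nat.eq_zero_or_pos n with rfl | hn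
    · exact ⟨0, 0, by simp [A3], by simp [A3], le_rfl, rfl⟩
    · obtain ⟨a, b, ha, hb, hab, h⟩ := ih (n / 3) (by omega)
      have hlt : n % 3 < 3 := Nat.mod_lt n (by norm_num)
      refine ⟨3 * a + n % 3 % 2, 3 * b + (n % 3 + 1) / 2,
        three_mul_add_mem_A3_s3 ha (by omega), three_mul_add_mem_A3_s3 hb (by omega),
        by omega, by omega⟩

theorem stmt_3 (n : ℕ) (hn : n ∉ A3) :
    ∃ a b : ℕ, a ∈ A3 ∧ b ∈ A3 ∧ a < b ∧ b < n ∧ a + n = 2 * b := by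
  obtain ⟨a, b, ha, hb, hab, h⟩ := exists_mem_A3_add_eq_two_mul n
  have hne : n ≠ b := fun e => hn (e ▸ hb)
  exact ⟨a, b, ha, hb, by omega, by omega, h⟩
end

section
/- Let F be a finite field with q elements and let s be a real number with s > 1. Then the infinite product over all monic irreducible polynomials p ∈ F[X] of (1 − q^(−s·deg p))^(−1) converges and equals 1/(1 − q^(1−s)). -/
open Polynomial Filter Topology

section FinsuppEulerProduct

variable {ι : Type*}

/-- Finitely supported exponent vectors with support in `insert i s` are pairs of an exponent
at `i` and an exponent vector with support in `s`. -/
noncomputable def finsuppInsertEquiv [DecidableEq ι] {i : ι} {s : Finset ι} (hi : i ∉ s) :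
    {a : ι →₀ ℕ // a.support ⊆ insert i s} ≃ ℕ × {a : ι →₀ ℕ // a.support ⊆ s} where
  toFun a := (a.1 i, ⟨a.1.erase i, by
    rw [Finsupp.support_erase]
    exact Finset.subset_insert_iff.mp a.2⟩)
  invFun b := ⟨Finsupp.single i b.1 + b.2.1, by
    refine Finsupp.support_add.trans (Finset.union_subset ?_ ?_)
    · exact Finsupp.support_single_subset.trans (by simp)
    · exact b.2.2.trans (Finset.subset_insert i s)⟩
  left_inv a := Subtype.ext (Finsupp.single_add_erase i a.1)
  right_inv b := by
    have h : i ∉ b.2.1.support := fun h ↦ hi (b.2.2 h)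
    refine Prod.ext ?_ (Subtype.ext ?_)
    · simpa using h
    · simp [Finsupp.erase_add, Finsupp.erase_of_notMem_support h]

theorem hasSum_prod_pow_of_support_subset {x : ι → ℝ} (h0 : ∀ i, 0 ≤ x i) (h1 : ∀ i, x i < 1)
    (s : Finset ι) :
    HasSum (fun a : {a : ι →₀ ℕ // a.support ⊆ s} ↦ a.1.prod fun i n ↦ x i ^ n)
      (∏ i ∈ s, (1 - x i)⁻¹) := by
  classical
  induction s using Finset.induction with
  | empty =>
    have : Unique {a : ι →₀ ℕ // a.support ⊆ ∅} :=
      { default := ⟨0, by simp⟩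
        uniq := fun a ↦ Subtype.ext (by simpa using a.2) }
    convert! hasSum_unique (fun a : {a : ι →₀ ℕ // a.support ⊆ ∅} ↦ a.1.prod fun i n ↦ x i ^ n)
    have h : (default : {a : ι →₀ ℕ // a.support ⊆ ∅}).1 = 0 := by
      simpa using (default : {a : ι →₀ ℕ // a.support ⊆ ∅}).2
    simp [h]
  | insert i s hi ih =>
    rw [Finset.prod_insert hi, ← (finsuppInsertEquiv hi).symm.hasSum_iff]
    have hg := hasSum_geometric_of_lt_one (h0 i) (h1 i)
    have hprod := hg.mul ih (hg.summable.mul_of_nonneg ih.summable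
      (fun n ↦ pow_nonneg (h0 i) n)
      (fun a ↦ Finset.prod_nonneg fun j _ ↦ pow_nonneg (h0 j) _))
    convert! hprod using 2 with b
    simp [finsuppInsertEquiv, Finsupp.prod_add_index', pow_add]

/-- The Euler product over the generators of a free commutative monoid. -/
theorem hasProd_one_sub_inv_of_hasSum_prod_pow {x : ι → ℝ} (h0 : ∀ i, 0 ≤ x i)
    (h1 : ∀ i, x i < 1) {S : ℝ} (hS : HasSum (fun a : ι →₀ ℕ ↦ a.prod fun i n ↦ x i ^ n) S) :
    HasProd (fun i ↦ (1 - x i)⁻¹) S := by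
  set f : (ι →₀ ℕ) → ℝ := fun a ↦ a.prod fun i n ↦ x i ^ n
  have key (s : Finset ι) :
      ∏ i ∈ s, (1 - x i)⁻¹ = ∑' a, Set.indicator {a : ι →₀ ℕ | a.support ⊆ s} f a := by
    rw [← tsum_subtype]
    exact (hasSum_prod_pow_of_support_subset h0 h1 s).tsum_eq.symm
  rw [HasProd, SummationFilter.unconditional_filter]
  simp_rw [key, ← hS.tsum_eq]
  refine tendsto_tsum_of_dominated_convergence hS.summable.norm (fun a ↦ ?_)
    (.of_forall fun s a ↦ norm_indicator_le_norm_self f a)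
  refine tendsto_const_nhds.congr' ?_
  filter_upwards [eventually_ge_atTop a.support] with s hs
  exact (Set.indicator_of_mem (s := {a : ι →₀ ℕ | a.support ⊆ s}) hs f).symm

end FinsuppEulerProduct

section MonicPolynomials

variable {F : Type*} [Field F]

/-- Unique factorization of monic polynomials, as a bijection. -/
theorem bijective_prod_monic_irreducible :
    Function.Bijective (fun a : {p : F[X] // p.Monic ∧ Irreducible p} →₀ ℕ ↦
      (⟨a.prod fun p n ↦ p.1 ^ n,
        monic_prod_of_monic _ _ fun p _ ↦ p.2.1.pow _⟩ : {f : F[X] // f.Monic})) := by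
  classical
  have hprod (a : {p : F[X] // p.Monic ∧ Irreducible p} →₀ ℕ) :
      (a.prod fun p n ↦ p.1 ^ n) = ((Finsupp.toMultiset a).map Subtype.val).prod := by
    rw [Finsupp.toMultiset_map, Finsupp.prod_toMultiset, Finsupp.prod_mapDomain_index] <;>
      simp [pow_add]
  constructor
  · intro a b hab
    have h : ((Finsupp.toMultiset a).map Subtype.val).prod
        = ((Finsupp.toMultiset b).map Subtype.val).prod := by
      rw [← hprod, ← hprod]
      exact congrArg Subtype.val hab
    have hfac (m : Multiset {p : F[X] // p.Monic ∧ Irreducible p}) :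
        UniqueFactorizationMonoid.normalizedFactors (m.map Subtype.val).prod
          = m.map Subtype.val := by
      rw [UniqueFactorizationMonoid.normalizedFactors_prod_eq]
      · rw [Multiset.map_map]
        exact Multiset.map_congr rfl fun p _ ↦ p.2.1.normalize_eq_self
      · intro p hp
        obtain ⟨p, -, rfl⟩ := Multiset.mem_map.mp hp
        exact p.2.2
    apply Function.LeftInverse.injective Finsupp.toMultiset_toFinsupp
    apply Multiset.map_injective Subtype.val_injective
    rw [← hfac, h, hfac]
  · rintro ⟨f, hf⟩
    obtain ⟨m, hm⟩ : ∃ m : Multiset {p : F[X] // p.Monic ∧ Irreducible p},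
        m.map Subtype.val = UniqueFactorizationMonoid.normalizedFactors f := by
      refine CanLift.prf (UniqueFactorizationMonoid.normalizedFactors f) fun p hp ↦ ?_
      have hirr := UniqueFactorizationMonoid.irreducible_of_normalized_factor p hp
      refine ⟨?_, hirr⟩
      rw [← UniqueFactorizationMonoid.normalize_normalized_factor p hp]
      exact monic_normalize hirr.ne_zero
    refine ⟨Multiset.toFinsupp m, Subtype.ext ?_⟩
    refine (hprod _).trans ?_
    rw [ Multiset.toFinsupp_toMultiset, hm,
      UniqueFactorizationMonoid.prod_normalizedFactors_eq hf.ne_zero, hf.normalize_eq_self]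

/-- The generating series of monic polynomials by degree. -/
theorem hasSum_pow_natDegree_monic [Fintype F] {t : ℝ} (ht : 0 ≤ t)
    (hqt : Fintype.card F * t < 1) :
    HasSum (fun f : {f : F[X] // f.Monic} ↦ t ^ f.1.natDegree)
      (1 - Fintype.card F * t)⁻¹ := by
  let e (n : ℕ) : {f : {f : F[X] // f.Monic} // f.1.natDegree = n} ≃ (Fin n → F) :=
    (Equiv.subtypeSubtypeEquivSubtypeInter _ (fun f : F[X] ↦ f.natDegree = n)).trans
      ((monicEquivDegreeLT n).trans (degreeLTEquiv F n).toEquiv)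
  rw [← (Equiv.sigmaFiberEquiv fun f : {f : F[X] // f.Monic} ↦ f.1.natDegree).hasSum_iff]
  have hfib (n : ℕ) : HasSum (fun f : {f : {f : F[X] // f.Monic} // f.1.natDegree = n} ↦
      t ^ f.1.1.natDegree) ((Fintype.card F * t) ^ n) := by
    rw [← (e n).symm.hasSum_iff]
    have h : ((fun f : {f : {f : F[X] // f.Monic} // f.1.natDegree = n} ↦
        t ^ f.1.1.natDegree) ∘ (e n).symm) = fun _ ↦ t ^ n :=
      funext fun v ↦ congrArg (t ^ ·) ((e n).symm v).2
    rw [h]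
    convert! hasSum_fintype (fun _ : Fin n → F ↦ t ^ n) using 1
    simp [mul_pow]
  have hg := hasSum_geometric_of_lt_one (by positivity) hqt
  have hsum : Summable ((fun f : {f : F[X] // f.Monic} ↦ t ^ f.1.natDegree) ∘
      Equiv.sigmaFiberEquiv fun f : {f : F[X] // f.Monic} ↦ f.1.natDegree) := by
    refine (summable_sigma_of_nonneg fun _ ↦ pow_nonneg ht _).mpr
      ⟨fun n ↦ (hfib n).summable, hg.summable.congr fun n ↦ (hfib n).tsum_eq.symm⟩
  exact (hsum.hasSum.sigma hfib).unique hg ▸ hsum.hasSum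

end MonicPolynomials

theorem stmt_5 (F : Type*) [Field F] [Fintype F] (q : ℕ) (hq : Fintype.card F = q)
    (s : ℝ) (hs : 1 < s) :
    HasProd (fun p : {p : Polynomial F // p.Monic ∧ Irreducible p} =>
        (1 - (q : ℝ) ^ (-(s * (p.1.natDegree : ℝ))))⁻¹)
      (1 / (1 - (q : ℝ) ^ (1 - s))) := by
  subst hq
  have hq1 : (1 : ℝ) < Fintype.card F := mod_cast Fintype.one_lt_card
  have hq0 : (0 : ℝ) < Fintype.card F := one_pos.trans hq1
  set t : ℝ := (Fintype.card F : ℝ) ^ (-s)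
  have ht0 : 0 ≤ t := by positivity
  have ht1 : t < 1 := Real.rpow_lt_one_of_one_lt_of_neg hq1 (by linarith)
  have hqt : (Fintype.card F : ℝ) ^ (1 - s) = Fintype.card F * t := by
    rw [sub_eq_add_neg, Real.rpow_add hq0, Real.rpow_one]
  have hpow (n : ℕ) : (Fintype.card F : ℝ) ^ (-(s * (n : ℝ))) = t ^ n := by
    rw [← neg_mul, Real.rpow_mul_natCast hq0.le]
  simp_rw [hpow, hqt, one_div]
  refine hasProd_one_sub_inv_of_hasSum_prod_pow (fun _ ↦ pow_nonneg ht0 _)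
    (fun p ↦ pow_lt_one₀ ht0 ht1 p.2.2.natDegree_pos.ne') ?_
  have hsum := (Equiv.ofBijective _ (bijective_prod_monic_irreducible (F := F))).hasSum_iff.mpr
    (hasSum_pow_natDegree_monic ht0
      (hqt ▸ Real.rpow_lt_one_of_one_lt_of_neg hq1 (by linarith)))
  convert! hsum using 2 with a
  simp only [Function.comp_apply, Equiv.ofBijective_apply, Finsupp.prod]
  rw [natDegree_prod_of_monic _ _ fun p _ ↦ p.2.1.pow _, ← Finset.prod_pow_eq_pow_sum]
  refine Finset.prod_congr rfl fun p _ ↦ ?_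
  rw [p.2.1.natDegree_pow, ← pow_mul, mul_comm]
end

section
/- Let F be a finite field with q elements, let m(n,q) denote the number of monic irreducible polynomials of degree n in F[X], and let s be a real number with s > 1. Then the infinite product over n ≥ 1 of (1 − q^(−ns))^(−m(n,q)) converges and equals 1/(1 − q^(1−s)). -/
/-- the number of monic irreducible polynomials of degree `n` over `F` -/
noncomputable def numMonicIrred (F : Type*) [Field F] [Fintype F] (n : ℕ) : ℕ :=
  Nat.card {p : Polynomial F // p.Monic ∧ Irreducible p ∧ p.natDegree = n}

open Polynomial UniqueFactorizationMonoid in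
/-- Gauss's formula: a finite field with `q` elements satisfies `∑ d ∣ n, d * m(d, q) = q ^ n`. -/
theorem sum_divisors_mul_numMonicIrred (F : Type*) [Field F] [Fintype F] {n : ℕ} (hn : n ≠ 0) :
    ∑ d ∈ n.divisors, d * numMonicIrred F d = Fintype.card F ^ n := by
  classical
  obtain ⟨c, hc⟩ := CharP.exists F
  have : Fact c.Prime := ⟨CharP.char_is_prime F c⟩
  have hq : 1 < Fintype.card F := Fintype.one_lt_card
  set f : F[X] := X ^ Fintype.card F ^ n - X
  have hf_ne : f ≠ 0 := FiniteField.X_pow_card_pow_sub_X_ne_zero F hn hq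
  have hf_monic : f.Monic := monic_X_pow_sub (by
    rw [degree_X]; exact_mod_cast Nat.one_lt_pow hn hq)
  have hdvd : c ∣ Fintype.card F ^ n :=
    dvd_pow ((CharP.cast_eq_zero_iff F c _).1 (FiniteField.cast_card_eq_zero F)) hn
  have hsq : Squarefree f := (galois_poly_separable c _ hdvd).squarefree
  have hnodup : (normalizedFactors f).Nodup := (squarefree_iff_nodup_normalizedFactors hf_ne).1 hsq
  have hmem (p : F[X]) : p ∈ (normalizedFactors f).toFinset ↔
      p.Monic ∧ Irreducible p ∧ p.natDegree ∣ n := by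
    rw [Multiset.mem_toFinset, Polynomial.mem_normalizedFactors_iff hf_ne]
    constructor
    · rintro ⟨hi, hm, hd⟩
      refine ⟨hm, hi, hi.natDegree_dvd_iff_dvd_X_pow_card_pow_sub_X.2 ?_⟩
      rwa [Nat.card_eq_fintype_card]
    · rintro ⟨hm, hi, hd⟩
      refine ⟨hi, hm, ?_⟩
      rw [hi.natDegree_dvd_iff_dvd_X_pow_card_pow_sub_X, Nat.card_eq_fintype_card] at hd
      exact hd
  have hprod : ∏ p ∈ (normalizedFactors f).toFinset, p = f := by
    have := leadingCoeff_mul_prod_normalizedFactors f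
    rw [hf_monic.leadingCoeff, C_1, one_mul] at this
    rw [Finset.prod_eq_multiset_prod, Multiset.toFinset_val, hnodup.dedup, Multiset.map_id', this]
  have hcard (d : ℕ) (hd : d ∈ n.divisors) :
      numMonicIrred F d = ((normalizedFactors f).toFinset.filter (·.natDegree = d)).card := by
    refine Nat.subtype_card _ fun p => ?_
    rw [Finset.mem_filter, hmem]
    refine ⟨fun ⟨⟨hm, hi, _⟩, h⟩ => ⟨hm, hi, h⟩, fun ⟨hm, hi, h⟩ => ⟨⟨hm, hi, ?_⟩, h⟩⟩
    exact h ▸ Nat.dvd_of_mem_divisors hd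
  calc ∑ d ∈ n.divisors, d * numMonicIrred F d
      = ∑ d ∈ n.divisors, ∑ p ∈ (normalizedFactors f).toFinset with p.natDegree = d,
          p.natDegree := by
        refine Finset.sum_congr rfl fun d hd => ?_
        rw [Finset.sum_congr rfl fun p hp => (Finset.mem_filter.1 hp).2, Finset.sum_const,
          hcard d hd, smul_eq_mul, mul_comm]
    _ = ∑ p ∈ (normalizedFactors f).toFinset, p.natDegree :=
        Finset.sum_fiberwise_of_maps_to
          (fun p hp => Nat.mem_divisors.2 ⟨((hmem p).1 hp).2.2, hn⟩) _
    _ = (∏ p ∈ (normalizedFactors f).toFinset, p).natDegree :=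
        (natDegree_prod_of_monic _ _ fun p hp => ((hmem p).1 hp).1).symm
    _ = Fintype.card F ^ n := by
        rw [hprod, FiniteField.X_pow_card_pow_sub_X_natDegree_eq F hn hq]

/-- The logarithm of the Euler product of `F[X]` at `u = q ^ (-s)`. -/
theorem hasSum_numMonicIrred_mul_log (F : Type*) [Field F] [Fintype F] {u : ℝ} (hu : 0 ≤ u)
    (hqu : Fintype.card F * u < 1) :
    HasSum (fun d : ℕ+ => numMonicIrred F d * -Real.log (1 - u ^ (d : ℕ)))
      (-Real.log (1 - Fintype.card F * u)) := by
  have hq : (1 : ℝ) ≤ Fintype.card F := by exact_mod_cast Fintype.card_pos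
  have hu1 : u < 1 := by nlinarith
  have hlog {x : ℝ} (h0 : 0 ≤ x) (h1 : x < 1) :
      HasSum (fun n : ℕ+ => x ^ (n : ℕ) / (n : ℝ)) (-Real.log (1 - x)) := by
    have := Real.hasSum_pow_div_log_of_abs_lt_one (abs_lt.2 ⟨by linarith, h1⟩)
    rw [← Equiv.pnatEquivNat.symm.hasSum_iff]
    simpa [Function.comp_def] using this
  let g : ℕ+ × ℕ+ → ℝ := fun x =>
    numMonicIrred F x.1 * ((u ^ (x.1 : ℕ)) ^ (x.2 : ℕ) / (x.2 : ℝ))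
  have hg0 : 0 ≤ g := fun x => by positivity
  have hinner (N : ℕ+) :
      HasSum (fun y : Nat.divisorsAntidiagonal N => g (sigmaAntidiagonalEquivProd ⟨N, y⟩))
        ((Fintype.card F * u) ^ (N : ℕ) / (N : ℝ)) := by
    have hterm (y : Nat.divisorsAntidiagonal N) : g (sigmaAntidiagonalEquivProd ⟨N, y⟩) =
        u ^ (N : ℕ) / (N : ℝ) * ((y.1.1 : ℝ) * numMonicIrred F y.1.1) := by
      obtain ⟨⟨a, b⟩, hy⟩ := y
      have hab := Nat.mem_divisorsAntidiagonal.1 hy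
      have hab0 : a * b ≠ 0 := hab.1.symm ▸ hab.2
      have ha : (a : ℝ) ≠ 0 := Nat.cast_ne_zero.2 (left_ne_zero_of_mul hab0)
      have hb : (b : ℝ) ≠ 0 := Nat.cast_ne_zero.2 (right_ne_zero_of_mul hab0)
      simp only [g, sigmaAntidiagonalEquivProd, divisorsAntidiagonalFactors, Equiv.coe_fn_mk,
        PNat.mk_coe, ← hab.1, ← pow_mul]
      push_cast
      field_simp
    simp only [hterm]
    convert hasSum_fintype _ using 1
    rw [← Finset.mul_sum, Finset.sum_coe_sort _
      (fun y : ℕ × ℕ => (y.1 : ℝ) * numMonicIrred F y.1),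
      Nat.sum_divisorsAntidiagonal (fun d _ => (d * numMonicIrred F d : ℝ)), mul_pow]
    have := sum_divisors_mul_numMonicIrred F N.ne_zero
    rw [← Nat.cast_pow, ← this]
    push_cast
    ring
  have houter := hlog (by positivity) hqu
  have hsum : Summable (g ∘ sigmaAntidiagonalEquivProd) := by
    refine (summable_sigma_of_nonneg fun x => hg0 _).2 ⟨fun N => (hinner N).summable, ?_⟩
    exact houter.summable.congr fun N => (hinner N).tsum_eq.symm
  have hg : HasSum g (-Real.log (1 - Fintype.card F * u)) :=
    sigmaAntidiagonalEquivProd.hasSum_iff.1 (HasSum.sigma_of_hasSum houter hinner hsum)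
  exact hg.prod_fiberwise fun d =>
    (hlog (by positivity) (pow_lt_one₀ hu hu1 d.ne_zero)).mul_left _

theorem stmt_6 (F : Type*) [Field F] [Fintype F] (q : ℕ) (hq : Fintype.card F = q)
    (s : ℝ) (hs : 1 < s) :
    HasProd (fun n : {n : ℕ // 1 ≤ n} =>
        ((1 - (q : ℝ) ^ (-((n.1 : ℝ) * s))) ^ numMonicIrred F n.1)⁻¹)
      (1 / (1 - (q : ℝ) ^ (1 - s))) := by
  have hq1 : (1 : ℝ) < q := by rw [← hq]; exact_mod_cast Fintype.one_lt_card
  have hq0 : (0 : ℝ) < q := by linarith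
  have hqu : (q : ℝ) * (q : ℝ) ^ (-s) = (q : ℝ) ^ (1 - s) := by
    rw [sub_eq_add_neg, Real.rpow_add hq0, Real.rpow_one]
  have hqu1 : (q : ℝ) ^ (1 - s) < 1 := Real.rpow_lt_one_of_one_lt_of_neg hq1 (by linarith)
  have hpow (n : ℕ) : (q : ℝ) ^ (-((n : ℝ) * s)) = ((q : ℝ) ^ (-s)) ^ n := by
    rw [← Real.rpow_mul_natCast hq0.le]; ring_nf
  have hpos (n : {n : ℕ // 1 ≤ n}) : 0 < 1 - (q : ℝ) ^ (-((n.1 : ℝ) * s)) := by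
    have hn : (0 : ℝ) < n.1 := by exact_mod_cast n.2
    have := Real.rpow_lt_one_of_one_lt_of_neg hq1 (neg_lt_zero.2 (mul_pos hn (by linarith : 0 < s)))
    linarith
  have key := hasSum_numMonicIrred_mul_log F (u := (q : ℝ) ^ (-s)) (by positivity)
    (by rw [hq, hqu]; exact hqu1)
  rw [hq, hqu] at key
  have hexp := key.rexp
  rw [Real.exp_neg, Real.exp_log (by linarith), ← one_div] at hexp
  have hfactor (n : {n : ℕ // 1 ≤ n}) :
      ((1 - (q : ℝ) ^ (-((n.1 : ℝ) * s))) ^ numMonicIrred F n.1)⁻¹ =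
        Real.exp (numMonicIrred F n.1 * -Real.log (1 - ((q : ℝ) ^ (-s)) ^ n.1)) := by
    rw [mul_neg, Real.exp_neg, Real.exp_nat_mul, ← hpow, Real.exp_log (hpos n)]
  rw [funext hfactor]
  exact hexp
end

section
/- Let F be a finite field with q elements, let A₃* denote the set of nonnegative integers none of whose base-3 digits equals 2, and let P ∈ F[X] be a monic irreducible polynomial with norm N(P) = q^(deg P). Then the set of nonzero polynomials f ∈ F[X] whose multiplicity of P lies in A₃* has asymptotic density (1 − 1/N(P)) · Σ_{i ∈ A₃*} N(P)^(−i), which equals (1 − 1/N(P)) · ∏_{i=0}^∞ (1 + N(P)^(−3^i)). -/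
theorem three_mul_mem_A3 (k : ℕ) : 3 * k ∈ A3 ↔ k ∈ A3 := by
  rcases Nat.eq_zero_or_pos k with rfl | hk
  · simp
  · simp [A3, Nat.digits_def' (b := 3) (n := 3 * k) (by norm_num) (by lia)]

theorem three_mul_add_one_mem_A3 (k : ℕ) : 3 * k + 1 ∈ A3 ↔ k ∈ A3 := by
  have h : (3 * k + 1) / 3 = k := by lia
  simp [A3, h, Nat.add_mod]

theorem three_mul_add_two_notMem_A3 (k : ℕ) : 3 * k + 2 ∉ A3 := by
  simp [A3, Nat.add_mod]

theorem sum_range_three_mul {M : Type*} [AddCommMonoid M] (f : ℕ → M) (n : ℕ) :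
    ∑ i ∈ Finset.range (3 * n), f i =
      ∑ k ∈ Finset.range n, (f (3 * k) + f (3 * k + 1) + f (3 * k + 2)) := by
  induction n with
  | zero => simp
  | succ n ih =>
    rw [mul_add, mul_one, Finset.sum_range_succ, Finset.sum_range_succ, Finset.sum_range_succ, ih,
      Finset.sum_range_succ]
    simp only [add_assoc]

theorem prod_one_add_pow_three_pow (n : ℕ) (x : ℝ) :
    ∏ i ∈ Finset.range n, (1 + x ^ 3 ^ i) =
      ∑ i ∈ Finset.range (3 ^ n), A3.indicator (fun i => x ^ i) i := by
  classical
  induction n generalizing x with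
  | zero => simp [zero_mem_A3]
  | succ n ih =>
    rw [Finset.prod_range_succ', pow_succ' 3 n, sum_range_three_mul]
    simp only [pow_succ' 3, pow_mul x 3, ih, pow_zero, pow_one]
    rw [Finset.sum_mul]
    refine Finset.sum_congr rfl fun k _ => ?_
    simp only [Set.indicator_apply, three_mul_mem_A3, three_mul_add_one_mem_A3,
      three_mul_add_two_notMem_A3, if_false]
    split_ifs <;> ring

theorem tsum_A3_pow_eq_tprod {x : ℝ} (h0 : 0 ≤ x) (h1 : x < 1) :
    ∑' i : A3, x ^ (i : ℕ) = ∏' i : ℕ, (1 + x ^ 3 ^ i) := by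
  rw [tsum_subtype A3 (fun i => x ^ i)]
  have hs : Summable (fun i : ℕ => x ^ i) := summable_geometric_of_lt_one h0 h1
  have hm : Multipliable (fun i : ℕ => 1 + x ^ 3 ^ i) :=
    Real.multipliable_one_add_of_summable
      (hs.comp_injective (Nat.pow_right_injective (by norm_num)))
  refine tendsto_nhds_unique ?_ hm.hasProd.tendsto_prod_nat
  simp only [prod_one_add_pow_three_pow]
  exact (hs.indicator A3).hasSum.tendsto_sum_nat.comp
    (tendsto_pow_atTop_atTop_of_one_lt (by norm_num))

namespace Polynomial

variable {F : Type*} [Field F]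

theorem mem_degreeLT_succ_iff_natDegree_le {f : F[X]} {n : ℕ} :
    f ∈ degreeLT F (n + 1) ↔ f.natDegree ≤ n := by
  rw [mem_degreeLT, natDegree_le_iff_degree_le, ← Order.lt_succ_iff]
  rfl

theorem image_mul_degreeLT {Q : F[X]} (hQ : Q.Monic) (n : ℕ) :
    (fun f => Q * f) '' (degreeLT F (n - Q.natDegree) : Set F[X]) =
      {f | f ∈ degreeLT F n ∧ Q ∣ f} := by
  ext f
  simp only [Set.mem_image, SetLike.mem_coe, Set.mem_ofPred_eq]
  have key (g : F[X]) : g ∈ degreeLT F (n - Q.natDegree) ↔ Q * g ∈ degreeLT F n := by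
    rcases eq_or_ne g 0 with rfl | hg
    · simp
    · rw [mem_degreeLT, mem_degreeLT, ← natDegree_lt_iff_degree_lt hg,
        ← natDegree_lt_iff_degree_lt (mul_ne_zero hQ.ne_zero hg),
        natDegree_mul hQ.ne_zero hg]
      lia
  constructor
  · rintro ⟨g, hg, rfl⟩
    exact ⟨(key g).1 hg, dvd_mul_right _ _⟩
  · rintro ⟨hf, g, rfl⟩
    exact ⟨g, (key g).2 hf, rfl⟩

variable [Fintype F]

theorem finite_degreeLT (n : ℕ) : (degreeLT F n : Set F[X]).Finite :=
  have : Finite (degreeLT F n) := Finite.of_equiv _ (degreeLTEquiv F n).toEquiv.symm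
  Set.toFinite _

theorem ncard_degreeLT (n : ℕ) : (degreeLT F n : Set F[X]).ncard = Fintype.card F ^ n := by
  rw [← Nat.card_coe_set_eq]
  simpa using Nat.card_congr (degreeLTEquiv F n).toEquiv

theorem ncard_degreeLT_dvd {Q : F[X]} (hQ : Q.Monic) (n : ℕ) :
    {f | f ∈ degreeLT F n ∧ Q ∣ f}.ncard = Fintype.card F ^ (n - Q.natDegree) := by
  rw [← image_mul_degreeLT hQ, Set.ncard_image_of_injective _ (mul_right_injective₀ hQ.ne_zero),
    ncard_degreeLT]

theorem ncard_degreeLT_pow_dvd_not_pow_succ_dvd {P : F[X]} (hP : P.Monic) (n k : ℕ) :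
    ({f | f ∈ degreeLT F n ∧ P ^ k ∣ f ∧ ¬ P ^ (k + 1) ∣ f}.ncard : ℝ) =
      (Fintype.card F : ℝ) ^ (n - k * P.natDegree) -
        (Fintype.card F : ℝ) ^ (n - (k + 1) * P.natDegree) := by
  have hset : {f | f ∈ degreeLT F n ∧ P ^ k ∣ f ∧ ¬ P ^ (k + 1) ∣ f} =
      {f | f ∈ degreeLT F n ∧ P ^ k ∣ f} \ {f | f ∈ degreeLT F n ∧ P ^ (k + 1) ∣ f} := by
    ext f
    simp only [Set.mem_ofPred_eq, Set.mem_sdiff]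
    tauto
  have hsub : {f | f ∈ degreeLT F n ∧ P ^ (k + 1) ∣ f} ⊆ {f | f ∈ degreeLT F n ∧ P ^ k ∣ f} :=
    fun f hf => ⟨hf.1, (pow_dvd_pow P k.le_succ).trans hf.2⟩
  have h := Set.ncard_sdiff_add_ncard_of_subset hsub
    ((finite_degreeLT n).subset fun f hf => hf.1)
  rw [← hset, ncard_degreeLT_dvd (hP.pow _), ncard_degreeLT_dvd (hP.pow _),
    hP.natDegree_pow, hP.natDegree_pow] at h
  rw [eq_sub_iff_add_eq]
  exact_mod_cast h

theorem ncard_multiplicity_mem {P : F[X]} (hP : P.Monic) (hirr : Irreducible P) (A : Set ℕ)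
    (n : ℕ) :
    ({f : F[X] | f ≠ 0 ∧ (∀ k : ℕ, P ^ k ∣ f → ¬ P ^ (k + 1) ∣ f → k ∈ A) ∧
        f ∈ degreeLT F n}.ncard : ℝ) =
      ∑' k, A.indicator (fun k => (Fintype.card F : ℝ) ^ (n - k * P.natDegree) -
        (Fintype.card F : ℝ) ^ (n - (k + 1) * P.natDegree)) k := by
  classical
  have hd : 0 < P.natDegree := hirr.natDegree_pos
  set S := {f : F[X] | f ≠ 0 ∧ (∀ k : ℕ, P ^ k ∣ f → ¬ P ^ (k + 1) ∣ f → k ∈ A) ∧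
        f ∈ degreeLT F n} with hS
  have hfin : S.Finite := (finite_degreeLT n).subset fun f hf => hf.2.2
  have hmult {f : F[X]} (hf : f ≠ 0) : FiniteMultiplicity P f :=
    FiniteMultiplicity.of_not_isUnit hirr.not_isUnit hf
  have hmaps : ∀ f ∈ hfin.toFinset, multiplicity P f ∈ (Finset.range n).filter (· ∈ A) := by
    intro f hf
    obtain ⟨hf0, hA, hdeg⟩ := hfin.mem_toFinset.1 hf
    have hdvd : P ^ multiplicity P f ∣ f := pow_multiplicity_dvd P f
    have hle := natDegree_le_of_dvd hdvd hf0
    rw [hP.natDegree_pow] at hle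
    rw [mem_degreeLT, ← natDegree_lt_iff_degree_lt hf0] at hdeg
    rw [Finset.mem_filter, Finset.mem_range]
    refine ⟨?_, hA _ hdvd ((hmult hf0).not_pow_dvd_of_multiplicity_lt (Nat.lt_succ_self _))⟩
    nlinarith
  rw [Set.ncard_eq_toFinset_card S hfin, Finset.card_eq_sum_card_fiberwise hmaps,
    tsum_eq_sum (s := (Finset.range n).filter (· ∈ A)), Nat.cast_sum]
  · refine Finset.sum_congr rfl fun k hk => ?_
    have hkA : k ∈ A := (Finset.mem_filter.1 hk).2
    rw [Set.indicator_of_mem hkA, ← ncard_degreeLT_pow_dvd_not_pow_succ_dvd hP,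
      ← Set.ncard_coe_finset]
    congr 2
    ext f
    simp only [Finset.coe_filter, Set.Finite.mem_toFinset, hS, Set.mem_ofPred_eq]
    constructor
    · rintro ⟨⟨hf0, -, hdeg⟩, rfl⟩
      exact ⟨hdeg, pow_multiplicity_dvd P f,
        (hmult hf0).not_pow_dvd_of_multiplicity_lt (Nat.lt_succ_self _)⟩
    · rintro ⟨hdeg, hk1, hk2⟩
      have hf0 : f ≠ 0 := by rintro rfl; exact hk2 (dvd_zero _)
      refine ⟨⟨hf0, fun j hj1 hj2 => ?_, hdeg⟩, multiplicity_eq_of_dvd_of_not_dvd hk1 hk2⟩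
      rwa [← multiplicity_eq_of_dvd_of_not_dvd hj1 hj2,
        multiplicity_eq_of_dvd_of_not_dvd hk1 hk2]
  · intro k hk
    by_cases hkA : k ∈ A
    · have hnk : n ≤ k := by simpa [hkA] using hk
      have h1 : n - k * P.natDegree = 0 := Nat.sub_eq_zero_of_le (by nlinarith)
      have h2 : n - (k + 1) * P.natDegree = 0 := Nat.sub_eq_zero_of_le (by nlinarith)
      simp [h1, h2]
    · exact Set.indicator_of_notMem hkA _

end Polynomial

theorem pow_sub_sub_pow_sub_div_le {q : ℝ} (hq : 1 < q) (d n k : ℕ) :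
    ‖(q ^ (n - k * d) - q ^ (n - (k + 1) * d)) / q ^ n‖ ≤ ((q ^ d)⁻¹) ^ k := by
  have hq0 : 0 < q := by linarith
  have hle : q ^ (n - (k + 1) * d) ≤ q ^ (n - k * d) :=
    pow_le_pow_right₀ hq.le (by gcongr; lia)
  rw [Real.norm_of_nonneg (by have := sub_nonneg.2 hle; positivity), inv_pow, ← pow_mul,
    mul_comm d k, div_le_iff₀ (by positivity), inv_mul_eq_div, le_div_iff₀ (by positivity)]
  rcases le_total (k * d) n with h | h
  · rw [sub_mul, ← pow_add, Nat.sub_add_cancel h]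
    have : 0 < q ^ (n - (k + 1) * d) * q ^ (k * d) := by positivity
    linarith
  · rw [Nat.sub_eq_zero_of_le h, Nat.sub_eq_zero_of_le (h.trans (by gcongr; lia))]
    simp only [pow_zero, sub_self, zero_mul]
    positivity

theorem tendsto_pow_sub_div_pow {q : ℝ} (hq : 1 < q) (m : ℕ) :
    Filter.Tendsto (fun n : ℕ => q ^ (n - m) / q ^ n) Filter.atTop (nhds (q ^ m)⁻¹) := by
  refine tendsto_const_nhds.congr' ?_
  filter_upwards [Filter.eventually_ge_atTop m] with n hn
  have hq0 : q ≠ 0 := by linarith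
  rw [pow_sub₀ q hq0 hn]
  field_simp

theorem tendsto_pow_sub_sub_pow_sub_div {q : ℝ} (hq : 1 < q) (d k : ℕ) :
    Filter.Tendsto (fun n : ℕ => (q ^ (n - k * d) - q ^ (n - (k + 1) * d)) / q ^ n)
      Filter.atTop (nhds ((1 - (q ^ d)⁻¹) * ((q ^ d)⁻¹) ^ k)) := by
  have h := (tendsto_pow_sub_div_pow hq (k * d)).sub (tendsto_pow_sub_div_pow hq ((k + 1) * d))
  convert h using 2
  · rw [sub_div]
  · rw [mul_comm k d, mul_comm (k + 1) d, pow_mul, pow_mul, ← inv_pow, ← inv_pow]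
    ring

theorem stmt_8 (F : Type*) [Field F] [Fintype F] (q : ℕ) (hq : Fintype.card F = q)
    (P : Polynomial F) (hmonic : P.Monic) (hirr : Irreducible P) :
    Filter.Tendsto
      (fun N : ℕ =>
        (Set.ncard {f : Polynomial F | f ≠ 0 ∧
            (∀ k : ℕ, P ^ k ∣ f → ¬ P ^ (k + 1) ∣ f → k ∈ A3) ∧ f.natDegree ≤ N} : ℝ) /
          (q : ℝ) ^ (N + 1))
      Filter.atTop
      (nhds ((1 - 1 / ((q : ℝ) ^ P.natDegree)) *
        ∑' i : A3, ((q : ℝ) ^ P.natDegree) ^ (-(i.1 : ℤ)))) ∧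
    (1 - 1 / ((q : ℝ) ^ P.natDegree)) * ∑' i : A3, ((q : ℝ) ^ P.natDegree) ^ (-(i.1 : ℤ)) =
      (1 - 1 / ((q : ℝ) ^ P.natDegree)) *
        ∏' i : ℕ, (1 + ((q : ℝ) ^ P.natDegree) ^ (-((3 : ℤ) ^ i))) := by
  have hq1 : (1 : ℝ) < q := by exact_mod_cast hq ▸ Fintype.one_lt_card
  set x : ℝ := ((q : ℝ) ^ P.natDegree)⁻¹ with hx
  have hx0 : 0 ≤ x := by positivity
  have hx1 : x < 1 := inv_lt_one_of_one_lt₀ (one_lt_pow₀ hq1 hirr.natDegree_pos.ne')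
  have hzpow (m : ℕ) : ((q : ℝ) ^ P.natDegree) ^ (-(m : ℤ)) = x ^ m := by
    rw [zpow_neg, zpow_natCast, hx, inv_pow]
  have hzpow_three (i : ℕ) : ((q : ℝ) ^ P.natDegree) ^ (-((3 : ℤ) ^ i)) = x ^ 3 ^ i := by
    rw [← hzpow]
    norm_cast
  simp only [hzpow, hzpow_three, one_div, ← hx]
  refine ⟨?_, by rw [tsum_A3_pow_eq_tprod hx0 hx1]⟩
  have hs : Summable (fun k : ℕ => x ^ k) := summable_geometric_of_lt_one hx0 hx1
  rw [tsum_subtype A3 (fun k => x ^ k), ← tsum_mul_left]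
  have hlim : Filter.Tendsto (fun n : ℕ => ∑' k, A3.indicator (fun k =>
      ((q : ℝ) ^ (n - k * P.natDegree) - (q : ℝ) ^ (n - (k + 1) * P.natDegree)) / (q : ℝ) ^ n) k)
      Filter.atTop (nhds (∑' k, (1 - x) * A3.indicator (fun k => x ^ k) k)) := by
    refine tendsto_tsum_of_dominated_convergence hs (fun k => ?_) (.of_forall fun n k => ?_)
    · by_cases hk : k ∈ A3
      · simpa only [Set.indicator_of_mem hk] using tendsto_pow_sub_sub_pow_sub_div hq1 _ k
      · simp [Set.indicator_of_notMem hk]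
    · exact (norm_indicator_le_norm_self _ _).trans (pow_sub_sub_pow_sub_div_le hq1 _ n k)
  refine (hlim.comp (Filter.tendsto_add_atTop_nat 1)).congr fun N => ?_
  have hcount := Polynomial.ncard_multiplicity_mem hmonic hirr A3 (N + 1)
  simp only [Polynomial.mem_degreeLT_succ_iff_natDegree_le, hq] at hcount
  rw [hcount, ← tsum_div_const, Function.comp_apply]
  refine tsum_congr fun k => ?_
  by_cases hk : k ∈ A3 <;> simp [hk]
end

section
/- For every real number x with 0 < x < 1, the sum Σ_{n ∈ A₃*} x^n converges and equals the convergent infinite product ∏_{i=0}^∞ (1 + x^(3^i)). -/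
lemma mem_A3_three_mul_add {m r : ℕ} (hm : m ∈ A3) (hr : r < 2) : 3 * m + r ∈ A3 := by
  rcases Nat.eq_zero_or_pos (3 * m + r) with h | h
  · simp [h, A3]
  · intro d hd
    rw [Nat.digits_def' (by norm_num) h, List.mem_cons] at hd
    rcases hd with rfl | hd
    · omega
    · rw [show (3 * m + r) / 3 = m by omega] at hd
      exact hm d hd

lemma sum_range_mul_three_pow_mem_A3 (N : ℕ) (f : ℕ → ℕ) (hf : ∀ i, f i < 2) :
    ∑ i ∈ Finset.range N, f i * 3 ^ i ∈ A3 := by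
  induction N generalizing f with
  | zero => simp [A3]
  | succ N ih =>
    have h := mem_A3_three_mul_add (ih (fun i => f (i + 1)) fun i => hf _) (hf 0)
    rw [Finset.sum_range_succ']
    convert h using 1
    rw [Finset.mul_sum, pow_zero, mul_one]
    congr 1
    exact Finset.sum_congr rfl fun i _ => by ring

lemma sum_three_pow_mem_A3 (s : Finset ℕ) : ∑ i ∈ s, 3 ^ i ∈ A3 := by
  obtain ⟨N, hN⟩ := s.exists_nat_subset_range
  have h := sum_range_mul_three_pow_mem_A3 N (fun i => if i ∈ s then 1 else 0)
    fun i => by split_ifs <;> norm_num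
  simpa [ite_mul, Finset.sum_ite_mem, Finset.inter_eq_right.mpr hN] using h

lemma exists_sum_three_pow_eq {n : ℕ} (hn : n ∈ A3) : ∃ s : Finset ℕ, ∑ i ∈ s, 3 ^ i = n := by
  induction n using Nat.strong_induction_on with
  | _ n ih =>
    rcases Nat.eq_zero_or_pos n with rfl | hpos
    · exact ⟨∅, by simp⟩
    have hd := Nat.digits_def' (b := 3) (by norm_num) hpos
    have hdiv : n / 3 ∈ A3 := fun d hd' => hn d (by rw [hd]; exact List.mem_cons_of_mem _ hd')
    have hmod : n % 3 ≠ 2 := hn _ (by rw [hd]; exact List.mem_cons_self)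
    obtain ⟨s, hs⟩ := ih (n / 3) (by omega) hdiv
    have hshift : ∑ i ∈ s.map (addRightEmbedding 1), 3 ^ i = 3 * (n / 3) := by
      rw [Finset.sum_map, ← hs, Finset.mul_sum]
      exact Finset.sum_congr rfl fun i _ => by rw [addRightEmbedding_apply, pow_succ']
    rcases (by omega : n % 3 = 0 ∨ n % 3 = 1) with h | h
    · exact ⟨s.map (addRightEmbedding 1), by omega⟩
    · refine ⟨insert 0 (s.map (addRightEmbedding 1)), ?_⟩
      rw [Finset.sum_insert (by simp), hshift, pow_zero]
      omega

/-- A finite set `s` of exponents corresponds to the element `∑ i ∈ s, 3 ^ i` of `A3`. -/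
noncomputable def finsetEquivA3 : Finset ℕ ≃ A3 :=
  Equiv.ofBijective (fun s => ⟨∑ i ∈ s, 3 ^ i, sum_three_pow_mem_A3 s⟩)
    ⟨fun _ _ h => Finset.geomSum_injective (by norm_num) (congrArg Subtype.val h), fun n =>
      (exists_sum_three_pow_eq n.2).imp fun _ hs => Subtype.ext hs⟩

theorem stmt_9 (x : ℝ) (h0 : 0 < x) (h1 : x < 1) :
    ∃ L : ℝ, HasSum (fun n : A3 => x ^ (n.1 : ℕ)) L ∧
      HasProd (fun i : ℕ => 1 + x ^ (3 ^ i)) L := by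
  obtain ⟨L, hL⟩ := (summable_geometric_of_lt_one h0.le h1).subtype A3
  refine ⟨L, hL, hasProd_one_add_of_hasSum_prod ?_⟩
  simp_rw [Finset.prod_pow_eq_pow_sum]
  exact finsetEquivA3.hasSum_iff.mpr hL
end

section
/- Let F be a finite field with q elements, let A₃* denote the set of nonnegative integers none of whose base-3 digits equals 2, and let S = {f ∈ F[X] : f ≠ 0 and deg f ∈ A₃*}. Then S contains no 3-term geometric progression with non-unit ratio: there do not exist a nonzero b ∈ F[X] and a nonzero non-unit r ∈ F[X] with b, r·b, and r²·b all in S. -/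
theorem A3.mod_three_ne_two {n : ℕ} (hn : n ∈ A3) : n % 3 ≠ 2 := by
  rcases Nat.eq_zero_or_pos n with rfl | hpos
  · decide
  · exact hn _ (by rw [Nat.digits_def' (by norm_num) hpos]; exact List.mem_cons_self)

theorem A3.div_three_mem {n : ℕ} (hn : n ∈ A3) : n / 3 ∈ A3 := by
  rcases Nat.eq_zero_or_pos n with rfl | hpos
  · exact hn
  · intro d hd
    exact hn d (by rw [Nat.digits_def' (by norm_num) hpos]; exact List.mem_cons_of_mem _ hd)

theorem stmt_11 (F : Type*) [Field F] [Fintype F]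
    (S : Set (Polynomial F)) (hS : S = {f : Polynomial F | f ≠ 0 ∧ f.natDegree ∈ A3}) :
    ¬ ∃ b r : Polynomial F, b ≠ 0 ∧ r ≠ 0 ∧ ¬ IsUnit r ∧
      b ∈ S ∧ r * b ∈ S ∧ r ^ 2 * b ∈ S := by
  subst hS
  rintro ⟨b, r, hb, hr, hu, ⟨-, h0⟩, ⟨-, h1⟩, ⟨-, h2⟩⟩
  rw [Polynomial.natDegree_mul hr hb] at h1
  rw [Polynomial.natDegree_mul (pow_ne_zero 2 hr) hb, Polynomial.natDegree_pow] at h2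
  have h := A3.eq_of_add_eq_two_mul h0 h1 h2 (by ring)
  have hdeg : r.natDegree = 0 := by omega
  refine hu (Polynomial.isUnit_iff_degree_eq_zero.2 ?_)
  rw [Polynomial.degree_eq_natDegree hr, hdeg, Nat.cast_zero]
end

section
/- Let F be a finite field with q elements and let D ⊆ ℕ be any set of nonnegative integers such that the set S(D) = {f ∈ F[X] : f ≠ 0 and deg f ∈ D} contains no 3-term geometric progression b, r·b, r²·b with b ≠ 0, r ≠ 0, and r not a unit. Then the upper density of S(D) is at most m_q = (1 − q^(−2)) · ∏_{i=1}^∞ (1 + q^(−3^i)). -/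
/-- The natural numbers below `3 ^ k` whose ternary digits are all `0` or `1`. -/
def ternaryZeroOne : ℕ → Finset ℕ
  | 0 => {0}
  | k + 1 => ternaryZeroOne k ∪ (ternaryZeroOne k).map (addRightEmbedding (3 ^ k))

lemma mem_ternaryZeroOne_succ {k n : ℕ} :
    n ∈ ternaryZeroOne (k + 1) ↔
      n ∈ ternaryZeroOne k ∨ ∃ m ∈ ternaryZeroOne k, m + 3 ^ k = n := by
  simp [ternaryZeroOne]

lemma lt_of_mem_ternaryZeroOne {k n : ℕ} (h : n ∈ ternaryZeroOne k) : n < 3 ^ k := by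
  induction k generalizing n with
  | zero => simp_all [ternaryZeroOne]
  | succ k ih =>
    rw [pow_succ]
    rcases mem_ternaryZeroOne_succ.1 h with h | ⟨m, hm, rfl⟩
    · have := ih h
      omega
    · have := ih hm
      omega

lemma sum_pow_ternaryZeroOne (x : ℝ) (k : ℕ) :
    ∑ n ∈ ternaryZeroOne k, x ^ n = ∏ i ∈ Finset.range k, (1 + x ^ 3 ^ i) := by
  induction k with
  | zero => simp [ternaryZeroOne]
  | succ k ih =>
    have hd : Disjoint (ternaryZeroOne k)
        ((ternaryZeroOne k).map (addRightEmbedding (3 ^ k))) := by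
      rw [Finset.disjoint_left]
      intro n hn hn'
      obtain ⟨m, -, rfl⟩ := Finset.mem_map.1 hn'
      have := lt_of_mem_ternaryZeroOne hn
      simp at this
    rw [ternaryZeroOne, Finset.sum_union hd, Finset.sum_map, Finset.prod_range_succ, ← ih]
    simp only [addRightEmbedding_apply, pow_add, ← Finset.sum_mul]
    ring

/-- The set `ternaryZeroOne k` is greedy: every omitted number completes a progression. -/
lemma exists_progression_of_notMem_ternaryZeroOne {k n : ℕ} (hn : n < 3 ^ k)
    (h : n ∉ ternaryZeroOne k) :
    ∃ a ∈ ternaryZeroOne k, ∃ b ∈ ternaryZeroOne k, a < b ∧ a + n = 2 * b := by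
  induction k generalizing n with
  | zero => simp_all [ternaryZeroOne]
  | succ k ih =>
    simp only [mem_ternaryZeroOne_succ, not_or, not_exists, not_and] at h ⊢
    rw [pow_succ] at hn
    rcases lt_or_ge n (3 ^ k) with h₁ | h₁
    · obtain ⟨a, ha, b, hb, hab, e⟩ := ih h₁ h.1
      exact ⟨a, .inl ha, b, .inl hb, hab, e⟩
    rcases lt_or_ge n (2 * 3 ^ k) with h₂ | h₂
    · obtain ⟨a, ha, b, hb, hab, e⟩ := ih (n := n - 3 ^ k) (by omega)
        fun hm ↦ h.2 _ hm (by omega)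
      exact ⟨_, .inr ⟨a, ha, rfl⟩, _, .inr ⟨b, hb, rfl⟩, by omega, by omega⟩
    · by_cases hm : n - 2 * 3 ^ k ∈ ternaryZeroOne k
      · have : 0 < 3 ^ k := by positivity
        exact ⟨_, .inl hm, _, .inr ⟨_, hm, rfl⟩, by omega, by omega⟩
      · obtain ⟨a, ha, b, hb, hab, e⟩ := ih (by omega) hm
        exact ⟨a, .inl ha, _, .inr ⟨b, hb, rfl⟩, by omega, by omega⟩

lemma sum_pow_le_pow_of_forall_lt {x : ℝ} (hx₀ : 0 ≤ x) (hx : x ≤ 1 / 2) (s : Finset ℕ) {n : ℕ}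
    (hs : ∀ a ∈ s, n < a) : ∑ a ∈ s, x ^ a ≤ x ^ n := by
  obtain ⟨M, hM⟩ := s.bddAbove
  calc ∑ a ∈ s, x ^ a ≤ ∑ a ∈ Finset.Ico (n + 1) (M + 1), x ^ a := by
        refine Finset.sum_le_sum_of_subset_of_nonneg (fun a ha ↦ ?_) fun _ _ _ ↦ by positivity
        have h₁ := hs a ha
        have h₂ := hM ha
        simp only [Finset.mem_Ico]
        omega
    _ ≤ x ^ (n + 1) / (1 - x) := geom_sum_Ico_le_of_lt_one hx₀ (by linarith)
    _ ≤ x ^ n := by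
        rw [div_le_iff₀ (by linarith), pow_succ]
        exact mul_le_mul_of_nonneg_left (by linarith) (by positivity)

lemma sum_pow_le_sum_pow_of_first_difference {x : ℝ} (hx₀ : 0 ≤ x) (hx : x ≤ 1 / 2)
    (s t : Finset ℕ) (h : ∀ n ∈ s, (∀ m < n, m ∈ s ↔ m ∈ t) → n ∈ t) :
    ∑ a ∈ s, x ^ a ≤ ∑ a ∈ t, x ^ a := by
  classical
  by_cases hst : s = t
  · rw [hst]
  have hex : ∃ n, ¬ (n ∈ s ↔ n ∈ t) := by
    simpa [Finset.ext_iff] using hst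
  set n := Nat.find hex
  have hn : ¬ (n ∈ s ↔ n ∈ t) := Nat.find_spec hex
  have hlt : ∀ m < n, m ∈ s ↔ m ∈ t := fun m hm ↦ not_not.1 (Nat.find_min hex hm)
  have hns : n ∉ s := fun hs ↦ hn (iff_of_true hs (h n hs hlt))
  have hnt : n ∈ t := by tauto
  have hsub : insert n (s.filter (· < n)) ⊆ t := by
    intro m hm
    rcases Finset.mem_insert.1 hm with rfl | hm
    · exact hnt
    · rw [Finset.mem_filter] at hm
      exact (hlt m hm.2).1 hm.1
  calc ∑ a ∈ s, x ^ a
      = ∑ a ∈ s with a < n, x ^ a + ∑ a ∈ s with ¬ a < n, x ^ a :=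
        (Finset.sum_filter_add_sum_filter_not _ _ _).symm
    _ ≤ ∑ a ∈ s with a < n, x ^ a + x ^ n := by
        gcongr
        refine sum_pow_le_pow_of_forall_lt hx₀ hx _ fun a ha ↦ ?_
        rw [Finset.mem_filter] at ha
        exact lt_of_le_of_ne (not_lt.1 ha.2) fun e ↦ hns (e ▸ ha.1)
    _ = ∑ a ∈ insert n (s.filter (· < n)), x ^ a := by
        rw [Finset.sum_insert (by simp), add_comm]
    _ ≤ ∑ a ∈ t, x ^ a :=
        Finset.sum_le_sum_of_subset_of_nonneg hsub fun _ _ _ ↦ by positivity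

lemma sum_pow_le_prod_of_progression_free {x : ℝ} (hx₀ : 0 ≤ x) (hx : x ≤ 1 / 2) (s : Finset ℕ)
    (hs : ∀ a ∈ s, ∀ b ∈ s, ∀ c ∈ s, a < b → a + c ≠ 2 * b) {k : ℕ} (hk : ∀ a ∈ s, a < 3 ^ k) :
    ∑ a ∈ s, x ^ a ≤ ∏ i ∈ Finset.range k, (1 + x ^ 3 ^ i) := by
  rw [← sum_pow_ternaryZeroOne]
  refine sum_pow_le_sum_pow_of_first_difference hx₀ hx _ _ fun n hn hlt ↦ ?_
  by_contra hnt
  obtain ⟨a, ha, b, hb, hab, e⟩ := exists_progression_of_notMem_ternaryZeroOne (hk n hn) hnt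
  exact hs a ((hlt a (by omega)).2 ha) b ((hlt b (by omega)).2 hb) n hn hab e

lemma one_sub_mul_prod_le_tprod {x : ℝ} (hx₀ : 0 ≤ x) (hx : x < 1) (k : ℕ) :
    (1 - x) * ∏ i ∈ Finset.range (k + 1), (1 + x ^ 3 ^ i) ≤
      (1 - x ^ 2) * ∏' i : ℕ, (1 + x ^ 3 ^ (i + 1)) := by
  have hsum : Summable fun i : ℕ ↦ x ^ 3 ^ (i + 1) := by
    refine Summable.of_nonneg_of_le (fun _ ↦ by positivity) (fun i ↦ ?_)
      (summable_geometric_of_lt_one hx₀ hx)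
    refine pow_le_pow_of_le_one hx₀ hx.le ?_
    exact (Nat.le_succ i).trans (Nat.lt_pow_self (by norm_num)).le
  have hmul : Multipliable fun i : ℕ ↦ 1 + x ^ 3 ^ (i + 1) :=
    Real.multipliable_one_add_of_summable hsum
  have hmono : Monotone fun n ↦ ∏ i ∈ Finset.range n, (1 + x ^ 3 ^ (i + 1)) := by
    refine monotone_nat_of_le_succ fun n ↦ ?_
    rw [Finset.prod_range_succ]
    have h₁ : 0 ≤ ∏ i ∈ Finset.range n, (1 + x ^ 3 ^ (i + 1)) :=
      Finset.prod_nonneg fun _ _ ↦ by positivity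
    have h₂ : 0 ≤ x ^ 3 ^ (n + 1) := by positivity
    nlinarith
  have hle := hmono.ge_of_tendsto hmul.tendsto_prod_tprod_nat k
  rw [Finset.prod_range_succ']
  calc (1 - x) * ((∏ i ∈ Finset.range k, (1 + x ^ 3 ^ (i + 1))) * (1 + x ^ 3 ^ 0))
      = (1 - x ^ 2) * ∏ i ∈ Finset.range k, (1 + x ^ 3 ^ (i + 1)) := by ring
    _ ≤ _ := mul_le_mul_of_nonneg_left hle (by nlinarith)

section Counting

open Polynomial

variable (F : Type*) [Field F] [Fintype F]

lemma ncard_degreeLT (n : ℕ) :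
    (degreeLT F n : Set F[X]).ncard = Fintype.card F ^ n := by
  rw [← Nat.card_coe_set_eq]
  have e : (degreeLT F n : Set F[X]) ≃ (Fin n → F) := (degreeLTEquiv F n).toEquiv
  rw [Nat.card_congr e]
  simp

lemma ncard_ne_zero_natDegree_eq (d : ℕ) :
    ({f : F[X] | f ≠ 0 ∧ f.natDegree = d}.ncard : ℝ) =
      (Fintype.card F : ℝ) ^ (d + 1) - (Fintype.card F : ℝ) ^ d := by
  have hset : {f : F[X] | f ≠ 0 ∧ f.natDegree = d} =
      (degreeLT F (d + 1) : Set F[X]) \ degreeLT F d := by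
    ext f
    by_cases hf : f = 0
    · simp [hf]
    · simp only [Set.mem_ofPred_eq, Set.mem_sdiff, SetLike.mem_coe, mem_degreeLT,
        degree_eq_natDegree hf, Nat.cast_lt]
      simp only [ne_eq, hf, not_false_eq_true, true_and]
      omega
  have hfin : (degreeLT F d : Set F[X]).Finite :=
    Set.finite_of_ncard_pos (by rw [ncard_degreeLT]; positivity)
  have hsub : (degreeLT F d : Set F[X]) ⊆ degreeLT F (d + 1) := degreeLT_mono (Nat.le_succ d)
  rw [hset, Set.ncard_sdiff hsub hfin, ncard_degreeLT, ncard_degreeLT, Nat.cast_sub]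
  · push_cast
    rfl
  · exact Nat.pow_le_pow_right Fintype.card_pos (Nat.le_succ d)

open Classical in
lemma ncard_natDegree_mem_div_le (D : Set ℕ) (N : ℕ) :
    ({f : F[X] | f ≠ 0 ∧ f.natDegree ∈ D ∧ f.natDegree ≤ N}.ncard : ℝ) /
        (Fintype.card F : ℝ) ^ (N + 1) ≤
      (1 - (Fintype.card F : ℝ)⁻¹) *
        ∑ j ∈ Finset.range (N + 1) with N - j ∈ D, ((Fintype.card F : ℝ)⁻¹) ^ j := by
  have hq : (0 : ℝ) < Fintype.card F := by exact_mod_cast Fintype.card_pos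
  set s := (Finset.range (N + 1)).filter fun j ↦ N - j ∈ D
  have hset : {f : F[X] | f ≠ 0 ∧ f.natDegree ∈ D ∧ f.natDegree ≤ N} =
      ⋃ j ∈ s, {f : F[X] | f ≠ 0 ∧ f.natDegree = N - j} := by
    ext f
    simp only [Set.mem_ofPred_eq, Set.mem_iUnion, s, Finset.mem_filter, Finset.mem_range]
    constructor
    · rintro ⟨h₀, hD, hN⟩
      have e : N - (N - f.natDegree) = f.natDegree := by omega
      exact ⟨N - f.natDegree, ⟨by omega, e.symm ▸ hD⟩, h₀, e.symm⟩
    · rintro ⟨j, ⟨-, hD⟩, h₀, e⟩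
      exact ⟨h₀, e ▸ hD, by omega⟩
  rw [div_le_iff₀ (by positivity), hset]
  calc _ ≤ ((∑ j ∈ s, {f : F[X] | f ≠ 0 ∧ f.natDegree = N - j}.ncard : ℕ) : ℝ) := by
        exact_mod_cast Finset.set_ncard_biUnion_le s _
    _ = _ := by
        push_cast
        rw [Finset.mul_sum, Finset.sum_mul]
        refine Finset.sum_congr rfl fun j hj ↦ ?_
        have hjN : j ≤ N := Nat.lt_succ_iff.1 (Finset.mem_range.1 (Finset.mem_filter.1 hj).1)
        obtain ⟨d, rfl⟩ := Nat.exists_eq_add_of_le hjN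
        rw [ncard_ne_zero_natDegree_eq, Nat.add_sub_cancel_left, inv_pow]
        field_simp
        ring

end Counting

theorem stmt_14 (F : Type*) [Field F] [Fintype F] (q : ℕ) (hq : Fintype.card F = q)
    (D : Set ℕ)
    (hfree : ¬ ∃ b r : Polynomial F, b ≠ 0 ∧ r ≠ 0 ∧ ¬ IsUnit r ∧
      (b ≠ 0 ∧ b.natDegree ∈ D) ∧ (r * b ≠ 0 ∧ (r * b).natDegree ∈ D) ∧
      (r ^ 2 * b ≠ 0 ∧ (r ^ 2 * b).natDegree ∈ D)) :
    Filter.limsup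
      (fun N : ℕ =>
        (Set.ncard {f : Polynomial F | f ≠ 0 ∧ f.natDegree ∈ D ∧ f.natDegree ≤ N} : ℝ) /
          (q : ℝ) ^ (N + 1))
      Filter.atTop ≤
    (1 - (q : ℝ) ^ (-2 : ℤ)) * ∏' i : ℕ, (1 + (q : ℝ) ^ (-(3 : ℤ) ^ (i + 1))) := by
  classical
  subst hq
  have hD : ∀ n d : ℕ, 0 < d → n ∈ D → n + d ∈ D → n + 2 * d ∉ D := by
    intro n d hd h₁ h₂ h₃
    refine hfree ⟨Polynomial.X ^ n, Polynomial.X ^ d, by simp, by simp, ?_, ⟨by simp, by simpa⟩,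
      ⟨by simp, ?_⟩, by simp, ?_⟩
    · exact fun h ↦ Polynomial.not_isUnit_X (isUnit_pow_iff hd.ne' |>.1 h)
    · rwa [← pow_add, Polynomial.natDegree_X_pow, add_comm]
    · rwa [← pow_mul, ← pow_add, Polynomial.natDegree_X_pow, add_comm, mul_comm]
  set x : ℝ := (Fintype.card F : ℝ)⁻¹ with hxdef
  have hx₀ : 0 ≤ x := by positivity
  have hx : x ≤ 1 / 2 := by
    have h2 : (2 : ℝ) ≤ Fintype.card F := by exact_mod_cast Fintype.one_lt_card (α := F)
    rw [one_div]
    exact inv_anti₀ (by norm_num) h2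
  have hrhs : (1 - (Fintype.card F : ℝ) ^ (-2 : ℤ)) *
      ∏' i : ℕ, (1 + (Fintype.card F : ℝ) ^ (-(3 : ℤ) ^ (i + 1))) =
      (1 - x ^ 2) * ∏' i : ℕ, (1 + x ^ 3 ^ (i + 1)) := by
    have h (n : ℕ) : (Fintype.card F : ℝ) ^ (-(n : ℤ)) = x ^ n := by
      rw [zpow_neg, zpow_natCast, inv_pow]
    congr 2
    · exact h 2
    · funext i
      rw [← h]
      push_cast
      rfl
  rw [hrhs]
  refine Filter.limsup_le_of_le ?_ (Filter.Eventually.of_forall fun N ↦ ?_)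
  · exact Filter.isCoboundedUnder_le_of_le _ (x := 0) fun N ↦ by positivity
  · refine (ncard_natDegree_mem_div_le F D N).trans
      (le_trans ?_ (one_sub_mul_prod_le_tprod hx₀ (by linarith) N))
    refine mul_le_mul_of_nonneg_left ?_ (by linarith)
    refine sum_pow_le_prod_of_progression_free hx₀ hx _ ?_ fun a ha ↦ ?_
    · intro a ha b hb c hc hab e
      simp only [Finset.mem_filter, Finset.mem_range] at ha hb hc
      refine hD (N - c) (b - a) (by omega) hc.2 ?_ ?_
      · convert hb.2 using 1
        omega
      · convert ha.2 using 1
        omega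
    · simp only [Finset.mem_filter, Finset.mem_range] at ha
      exact ha.1.trans (Nat.lt_pow_self (by norm_num))
end
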